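/- Let K be any field and H, G finite groups. If K(H) is rational (purely transcendental) over K, then there exists a K-embedding ι : K(G) → K(H × G) such that K(H × G) is rational over the subfield ι(K(G)). In particular, if both K(H) and K(G) are rational over K, then K(H × G) is rational over K. -/

import Mathlib

set_option synthInstance.maxHeartbeats 1000000
set_option maxHeartbeats 1000000

noncomputable section

/-- The rational function field `K(x(g) : g ∈ G)` in variables indexed by `G`. -/
abbrev NoetherBigField (K : Type*) [Field K] (G : Type*) : Type _ :=
  FractionRing (MvPolynomial G K)

/-- The `K`-automorphism of `K(x(g) : g ∈ G)` induced by `h · x(g) = x(hg)`. -/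
def noetherAut (K : Type*) [Field K] (G : Type*) [Group G] (h : G) :
    NoetherBigField K G ≃ₐ[K] NoetherBigField K G :=
  IsFractionRing.algEquivOfAlgEquiv (MvPolynomial.renameEquiv K (Equiv.mulLeft h))

/-- The fixed field `K(G) = K(x(g) : g ∈ G)^G`, as a subfield. -/
def noetherSubfield (K : Type*) [Field K] (G : Type*) [Group G] :
    Subfield (NoetherBigField K G) where
  carrier := {x | ∀ h : G, noetherAut K G h x = x}
  mul_mem' := by intro a b ha hb h; rw [map_mul, ha h, hb h]
  one_mem' := by intro h; rw [map_one]
  add_mem' := by intro a b ha hb h; rw [map_add, ha h, hb h]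
  zero_mem' := by intro h; rw [map_zero]
  neg_mem' := by intro a ha h; rw [map_neg, ha h]
  inv_mem' := by intro a ha h; rw [map_inv₀, ha h]

/-- Noether's fixed field `K(G) = K(x(g) : g ∈ G)^G`. -/
def NoetherField (K : Type*) [Field K] (G : Type*) [Group G] : Type _ :=
  noetherSubfield K G

instance (K : Type*) [Field K] (G : Type*) [Group G] : Field (NoetherField K G) :=
  inferInstanceAs (Field (noetherSubfield K G))

theorem algebraMap_mem_noetherSubfield (K : Type*) [Field K] (G : Type*) [Group G] (c : K) :
    algebraMap K (NoetherBigField K G) c ∈ noetherSubfield K G := by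
  intro h
  exact AlgEquiv.commutes _ c

instance (K : Type*) [Field K] (G : Type*) [Group G] : Algebra K (NoetherField K G) :=
  RingHom.toAlgebra <|
    ((algebraMap K (NoetherBigField K G)).codRestrict (noetherSubfield K G).toSubring
      (algebraMap_mem_noetherSubfield K G))

/-- An extension `L/F` is rational (purely transcendental) if `L` is `F`-isomorphic to a
rational function field `F(t₁, …, tₙ)` over `F` in finitely many variables. -/
def IsRationalExtension (F L : Type*) [Field F] [Field L] [Algebra F L] : Prop :=
  ∃ n : ℕ, Nonempty (L ≃ₐ[F] FractionRing (MvPolynomial (Fin n) F))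

/-- An extension `L/F` is stably rational if the rational function field `L(y₁, …, y_r)`
is rational over `F` for some finite number `r` of indeterminates. -/
def IsStablyRationalExtension (F L : Type*) [Field F] [Field L] [Algebra F L] : Prop :=
  ∃ r : ℕ, IsRationalExtension F (FractionRing (MvPolynomial (Fin r) L))

section general
open Cardinal

theorem aux_of_gen {F L : Type*} [Field F] [Field L] [Algebra F L] {ι : Type*} [Finite ι]
    (v : ι → L) (hv : IntermediateField.adjoin F (Set.range v) = ⊤) {N : ℕ}
    (hN : Algebra.trdeg F L = N) (hc : Nat.card ι ≤ N) : IsTranscendenceBasis F v := by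
  have : Algebra.IsAlgebraic (Algebra.adjoin F (Set.range v)) L := by
    constructor
    intro a
    have ha : a ∈ IntermediateField.adjoin F (Set.range v) := by rw [hv]; trivial
    obtain ⟨r, hr, s, hs, rfl⟩ := IntermediateField.mem_adjoin_iff_div.1 ha
    have h1 := isAlgebraic_algebraMap (R := Algebra.adjoin F (Set.range v)) (A := L) ⟨r, hr⟩
    have h2 := isAlgebraic_algebraMap (R := Algebra.adjoin F (Set.range v)) (A := L) ⟨s, hs⟩
    rw [div_eq_mul_inv]
    exact h1.mul h2.inv
  apply Algebra.IsAlgebraic.isTranscendenceBasis_of_lift_le_trdeg_of_finite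
  have := Fintype.ofFinite ι
  rw [hN]
  simpa [Nat.card_eq_fintype_card] using hc

theorem aux_trdeg_frac (F : Type*) [Field F] (ι : Type*) [Finite ι] :
    Algebra.trdeg F (FractionRing (MvPolynomial ι F)) = (Nat.card ι : Cardinal) := by
  have : Algebra.IsAlgebraic (MvPolynomial ι F) (FractionRing (MvPolynomial ι F)) :=
    IsLocalization.isAlgebraic _ (nonZeroDivisors (MvPolynomial ι F))
  have h := (IsTranscendenceBasis.mvPolynomial ι F).algebraMap_comp
    (A := FractionRing (MvPolynomial ι F))
  have := Fintype.ofFinite ι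
  have := h.lift_cardinalMk_eq_trdeg
  simp at this
  rw [← this]
  simp

theorem aux_frac_gen (F : Type*) [Field F] (ι : Type*) :
    IntermediateField.adjoin F (Set.range
      (fun i => algebraMap (MvPolynomial ι F) (FractionRing (MvPolynomial ι F)) (MvPolynomial.X i)))
      = ⊤ := by
  rw [eq_top_iff]
  intro a _
  obtain ⟨p, q, hq, rfl⟩ := IsFractionRing.div_surjective (A := MvPolynomial ι F) a
  have key : ∀ p : MvPolynomial ι F, algebraMap (MvPolynomial ι F) (FractionRing (MvPolynomial ι F)) p
      ∈ IntermediateField.adjoin F (Set.range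
      (fun i => algebraMap (MvPolynomial ι F) (FractionRing (MvPolynomial ι F)) (MvPolynomial.X i))) := by
    intro p
    induction p using MvPolynomial.induction_on with
    | C a => 
      have : algebraMap (MvPolynomial ι F) (FractionRing (MvPolynomial ι F)) (MvPolynomial.C a)
        = algebraMap F _ a := by
        rw [IsScalarTower.algebraMap_apply F (MvPolynomial ι F) (FractionRing (MvPolynomial ι F))]; rfl
      rw [this]
      exact IntermediateField.algebraMap_mem _ _
    | add p q hp hq => rw [map_add]; exact add_mem hp hq
    | mul_X p i hp =>
      rw [map_mul]; exact mul_mem hp (IntermediateField.subset_adjoin _ _ ⟨i, rfl⟩)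
  exact div_mem (key p) (key q)

theorem aux_frac_indep (F : Type*) [Field F] (ι : Type*) :
    AlgebraicIndependent F
      (fun i => algebraMap (MvPolynomial ι F) (FractionRing (MvPolynomial ι F)) (MvPolynomial.X i)) := by
  have : Algebra.IsAlgebraic (MvPolynomial ι F) (FractionRing (MvPolynomial ι F)) :=
    IsLocalization.isAlgebraic _ (nonZeroDivisors (MvPolynomial ι F))
  exact ((IsTranscendenceBasis.mvPolynomial ι F).algebraMap_comp
    (A := FractionRing (MvPolynomial ι F))).1

theorem aux_rational_of {F L : Type*} [Field F] [Field L] [Algebra F L] {ι : Type*} [Finite ι]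
    (v : ι → L) (hi : AlgebraicIndependent F v)
    (hv : IntermediateField.adjoin F (Set.range v) = ⊤) : IsRationalExtension F L := by
  obtain ⟨n, ⟨e⟩⟩ := Finite.exists_equiv_fin ι
  refine ⟨n, ⟨?_⟩⟩
  have h1 := (hi.aevalEquivField.trans (IntermediateField.equivOfEq hv)).trans
    IntermediateField.topEquiv
  have h2 : FractionRing (MvPolynomial ι F) ≃ₐ[F] FractionRing (MvPolynomial (Fin n) F) :=
    IsFractionRing.algEquivOfAlgEquiv (MvPolynomial.renameEquiv F e)
  exact h1.symm.trans h2

theorem aux_rational_iff {F L : Type*} [Field F] [Field L] [Algebra F L]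
    (h : IsRationalExtension F L) : ∃ (n : ℕ) (v : Fin n → L), AlgebraicIndependent F v ∧
      IntermediateField.adjoin F (Set.range v) = ⊤ ∧ Algebra.trdeg F L = n := by
  obtain ⟨n, ⟨e⟩⟩ := h
  refine ⟨n, fun i => e.symm (algebraMap (MvPolynomial (Fin n) F) _ (MvPolynomial.X i)), ?_, ?_, ?_⟩
  · exact (aux_frac_indep F (Fin n)).map' (f := e.symm.toAlgHom) e.symm.injective
  · have := congrArg (IntermediateField.map e.symm.toAlgHom) (aux_frac_gen F (Fin n))
    rw [IntermediateField.adjoin_map] at this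
    rw [← Set.range_comp] at this
    refine Eq.trans this ?_
    rw [eq_top_iff]
    intro x _
    exact ⟨e x, trivial, e.symm_apply_apply x⟩
  · have := e.lift_trdeg_eq
    rw [aux_trdeg_frac] at this
    simpa using this

theorem aux_rational_trans {K F L : Type*} [Field K] [Field F] [Field L] [Algebra K F] [Algebra F L]
    [Algebra K L] [IsScalarTower K F L] (h1 : IsRationalExtension K F)
    (h2 : IsRationalExtension F L) : IsRationalExtension K L := by
  obtain ⟨n, v, hv, hv', hn⟩ := aux_rational_iff h1
  obtain ⟨m, w, hw, hw', hm⟩ := aux_rational_iff h2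
  have key : IntermediateField.adjoin K (Set.range (Sum.elim w (algebraMap F L ∘ v))) = ⊤ := by
    rw [eq_top_iff]
    set N := IntermediateField.adjoin K (Set.range (Sum.elim w (algebraMap F L ∘ v))) with hN
    have hF : ∀ a : F, algebraMap F L a ∈ N := by
      have : (⊤ : IntermediateField K F) ≤ N.comap (IsScalarTower.toAlgHom K F L) := by
        rw [← hv', IntermediateField.adjoin_le_iff]
        rintro _ ⟨i, rfl⟩
        exact IntermediateField.subset_adjoin _ _ ⟨Sum.inr i, rfl⟩
      intro a
      exact this (x := a) trivial
    let N' : IntermediateField F L := N.toSubfield.toIntermediateField hF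
    have : (⊤ : IntermediateField F L) ≤ N' := by
      rw [← hw', IntermediateField.adjoin_le_iff]
      rintro _ ⟨i, rfl⟩
      have h3 : w i ∈ N := IntermediateField.subset_adjoin _ _ ⟨Sum.inl i, rfl⟩
      exact h3
    intro x _
    exact this (x := x) trivial
  refine aux_rational_of _ (aux_of_gen _ key (N := n + m) ?_ (by simp; omega)).1 key
  have := lift_trdeg_add_eq K F L
  rw [hn, hm, Cardinal.lift_natCast, Cardinal.lift_natCast, ← Nat.cast_add] at this
  exact Cardinal.lift_eq_nat_iff.1 this.symm

/-- Lagrange interpolation. -/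
theorem aux_vandermonde {K L : Type*} [Field K] [Field L] [Algebra K L] (N : IntermediateField K L)
    {ι : Type*} [Fintype ι] (y w : ι → L) (hy : Function.Injective y) (hyN : ∀ i, y i ∈ N)
    (h : ∀ k < Fintype.card ι, ∑ i, y i ^ k * w i ∈ N) (i : ι) : w i ∈ N := by
  classical
  let y' : ι → N := fun i => ⟨y i, hyN i⟩
  have hy' : Set.InjOn y' (Finset.univ : Finset ι) := fun a _ b _ hab => hy (congrArg Subtype.val hab)
  let P : Polynomial N := Lagrange.basis Finset.univ y' i
  have hd : P.natDegree < Fintype.card ι := by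
    have := Lagrange.degree_basis hy' (Finset.mem_univ i)
    have h2 : P.natDegree = _ := Polynomial.natDegree_eq_of_degree_eq_some this
    have : 0 < Fintype.card ι := Fintype.card_pos_iff.2 ⟨i⟩
    rw [h2, Finset.card_univ]; omega
  have hev : ∀ j, Polynomial.aeval (y j) P = if j = i then 1 else 0 := by
    intro j
    have : y j = algebraMap N L (y' j) := rfl
    rw [this, Polynomial.aeval_algebraMap_apply, Polynomial.coe_aeval_eq_eval]
    split_ifs with hji
    · subst hji; rw [Lagrange.eval_basis_self hy' (Finset.mem_univ _)]; simp
    · rw [Lagrange.eval_basis_of_ne (Ne.symm hji) (Finset.mem_univ _)]; simp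
  have : w i = ∑ k ∈ Finset.range (Fintype.card ι), (P.coeff k : L) * ∑ j, y j ^ k * w j := by
    simp_rw [Finset.mul_sum]
    rw [Finset.sum_comm]
    calc w i = ∑ j, Polynomial.aeval (y j) P * w j := by simp [hev]
      _ = _ := by
        refine Finset.sum_congr rfl fun j _ => ?_
        rw [Polynomial.aeval_eq_sum_range' hd, Finset.sum_mul]
        refine Finset.sum_congr rfl fun k _ => ?_
        rw [Algebra.smul_def, mul_assoc]; rfl
  rw [this]
  refine sum_mem fun k hk => mul_mem (P.coeff k).2 (h k (Finset.mem_range.1 hk))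

end general

section noether
variable {K : Type*} [Field K]

def nx (K : Type*) [Field K] {ι : Type*} (i : ι) : FractionRing (MvPolynomial ι K) :=
  algebraMap (MvPolynomial ι K) _ (MvPolynomial.X i)

theorem aux_hom_ext {ι L : Type*} [Field L] [Algebra K L]
    (f g : FractionRing (MvPolynomial ι K) →ₐ[K] L) (h : ∀ i, f (nx K i) = g (nx K i)) (a) :
    f a = g a := by
  have key : (f : FractionRing (MvPolynomial ι K) →+* L) = g := by
    apply IsLocalization.ringHom_ext (nonZeroDivisors (MvPolynomial ι K))
    have : (f.comp (IsScalarTower.toAlgHom K (MvPolynomial ι K) _)) =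
        (g.comp (IsScalarTower.toAlgHom K (MvPolynomial ι K) _)) := by
      apply MvPolynomial.algHom_ext
      exact h
    exact congrArg AlgHom.toRingHom this
  exact congrArg (fun φ : FractionRing (MvPolynomial ι K) →+* L => φ a) key

/-- substitution hom -/
def nphi {ι L : Type*} [Field L] [Algebra K L] (y : ι → L) (hy : AlgebraicIndependent K y) :
    FractionRing (MvPolynomial ι K) →ₐ[K] L :=
  (IntermediateField.val _).comp hy.aevalEquivField.toAlgHom

theorem nphi_nx {ι L : Type*} [Field L] [Algebra K L] (y : ι → L) (hy : AlgebraicIndependent K y)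
    (i : ι) : nphi y hy (nx K i) = y i := by
  have := hy.aevalEquivField_algebraMap_apply_coe (MvPolynomial.X i)
  rw [MvPolynomial.aeval_X] at this
  exact this

variable {G : Type*} [Group G]

theorem noetherAut_nx (h g : G) : noetherAut K G h (nx K g) = nx K (h * g) := by
  unfold noetherAut nx
  rw [IsFractionRing.algEquivOfAlgEquiv_algebraMap]
  simp

theorem noetherAut_mul (h h' : G) (a : NoetherBigField K G) :
    noetherAut K G (h * h') a = noetherAut K G h (noetherAut K G h' a) := by
  refine aux_hom_ext (noetherAut K G (h * h')).toAlgHom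
    ((noetherAut K G h).toAlgHom.comp (noetherAut K G h').toAlgHom) (fun i => ?_) a
  change noetherAut K G (h * h') _ = noetherAut K G h (noetherAut K G h' _)
  simp only [noetherAut_nx, mul_assoc]

theorem noetherAut_one (a : NoetherBigField K G) : noetherAut K G 1 a = a := by
  refine aux_hom_ext (noetherAut K G 1).toAlgHom (AlgHom.id K _) (fun i => ?_) a
  change noetherAut K G 1 _ = _
  simp only [noetherAut_nx, one_mul]
  rfl

def nval (K : Type*) [Field K] (G : Type*) [Group G] : NoetherField K G →ₐ[K] NoetherBigField K G :=
  { (noetherSubfield K G).subtype with commutes' := fun _ => rfl }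

theorem nval_fixed (a : NoetherField K G) (h : G) : noetherAut K G h (nval K G a) = nval K G a :=
  a.2 h

theorem nval_surj (b : NoetherBigField K G) (hb : ∀ h, noetherAut K G h b = b) :
    ∃ a, nval K G a = b := ⟨⟨b, hb⟩, rfl⟩

theorem noether_trdeg (K : Type*) [Field K] (G : Type*) [Group G] [Finite G] :
    Algebra.trdeg K (NoetherField K G) = (Nat.card G : Cardinal) := by
  let _ : MulSemiringAction G (NoetherBigField K G) :=
    { smul := fun h a => noetherAut K G h a
      one_smul := noetherAut_one
      mul_smul := noetherAut_mul
      smul_zero := fun h => map_zero (noetherAut K G h)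
      smul_add := fun h => map_add (noetherAut K G h)
      smul_one := fun h => map_one (noetherAut K G h)
      smul_mul := fun h => map_mul (noetherAut K G h) }
  let _ : Algebra (NoetherField K G) (NoetherBigField K G) := (nval K G).toRingHom.toAlgebra
  have : IsScalarTower K (NoetherField K G) (NoetherBigField K G) :=
    IsScalarTower.of_algHom (nval K G)
  have : Algebra.IsInvariant (NoetherField K G) (NoetherBigField K G) G :=
    ⟨fun b hb => nval_surj b hb⟩
  have := Algebra.IsInvariant.isIntegral (NoetherField K G) (NoetherBigField K G) G
  have h0 : Algebra.trdeg (NoetherField K G) (NoetherBigField K G) = 0 :=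
    trdeg_eq_zero
  have h := lift_trdeg_add_eq K (NoetherField K G) (NoetherBigField K G)
  rw [h0, aux_trdeg_frac] at h
  simpa using h

theorem trfix [Fintype G] (b : NoetherBigField K G) :
    ∃ w, nval K G w = ∑ γ, noetherAut K G γ b := by
  refine nval_surj _ fun h => ?_
  rw [map_sum]
  simp_rw [← noetherAut_mul]
  exact Fintype.sum_equiv (Equiv.mulLeft h) _ _ (fun _ => rfl)

theorem aux_ne_zero {ι : Type*} (f : ι → K) (p : MvPolynomial ι K) (hp : MvPolynomial.eval f p ≠ 0) :
    algebraMap (MvPolynomial ι K) (FractionRing (MvPolynomial ι K)) p ≠ 0 := by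
  intro h
  apply hp
  have : p = 0 := by
    apply IsFractionRing.injective (MvPolynomial ι K) (FractionRing (MvPolynomial ι K))
    rw [h, map_zero]
  rw [this, map_zero]

theorem sne [Fintype G] : ∑ γ : G, nx K γ ≠ 0 := by
  classical
  have := aux_ne_zero (K := K) (fun g : G => if g = 1 then 1 else 0) (∑ γ : G, MvPolynomial.X γ)
    (by simp)
  rw [map_sum] at this
  exact this

theorem trone [Fintype G] : ∑ γ, noetherAut K G γ (nx K 1 / ∑ γ : G, nx K γ) = 1 := by
  simp_rw [map_div₀, map_sum, noetherAut_nx, mul_one]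
  have : ∀ x : G, ∑ γ : G, nx K (x * γ) = ∑ γ : G, nx K γ := fun x =>
    Fintype.sum_equiv (Equiv.mulLeft x) _ _ (fun _ => rfl)
  simp_rw [this]
  rw [← Finset.sum_div, div_self sne]

theorem nphi_equiv {Γ : Type*} [Group Γ] (π : Γ → G) (z : G → NoetherBigField K Γ)
    (hz : AlgebraicIndependent K z) (ez : ∀ p g, noetherAut K Γ p (z g) = z (π p * g)) (p : Γ)
    (b : NoetherBigField K G) :
    noetherAut K Γ p (nphi z hz b) = nphi z hz (noetherAut K G (π p) b) := by
  refine aux_hom_ext ((noetherAut K Γ p).toAlgHom.comp (nphi z hz))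
    ((nphi z hz).comp (noetherAut K G (π p)).toAlgHom) (fun i => ?_) b
  change noetherAut K Γ p (nphi z hz _) = nphi z hz (noetherAut K G (π p) _)
  rw [noetherAut_nx, nphi_nx, nphi_nx, ez]

/-- The fixed-field criterion. -/
theorem aux_core {H G : Type*} [Group H] [Group G] [Finite H] [Finite G]
    (y : H → NoetherBigField K (H × G)) (z : G → NoetherBigField K (H × G))
    (hy : AlgebraicIndependent K y) (hz : AlgebraicIndependent K z)
    (ey : ∀ p h, noetherAut K (H × G) p (y h) = y (p.1 * h))
    (ez : ∀ p g, noetherAut K (H × G) p (z g) = z (p.2 * g))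
    (M : IntermediateField K (NoetherBigField K (H × G)))
    (hM : ∀ p, ∀ a ∈ M, noetherAut K (H × G) p a = a)
    (hMy : ∀ w : NoetherField K H, nphi y hy (nval K H w) ∈ M)
    (hMz : ∀ w : NoetherField K G, nphi z hz (nval K G w) ∈ M)
    (hgen : ∀ N : IntermediateField K (NoetherBigField K (H × G)),
      M ≤ N → (∀ h, y h ∈ N) → (∀ g, z g ∈ N) → N = ⊤)
    (a : NoetherBigField K (H × G)) (ha : ∀ p, noetherAut K (H × G) p a = a) : a ∈ M := by
  classical
  have := Fintype.ofFinite H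
  have := Fintype.ofFinite G
  -- equivariance of the substitutions
  have eφy := nphi_equiv (fun p : H × G => p.1) y hy ey
  have eφz := nphi_equiv (fun p : H × G => p.2) z hz ez
  -- traces lie in `M`
  have tr2 : ∀ b c, ∑ p, noetherAut K (H × G) p (nphi y hy b * nphi z hz c) =
        nphi y hy (∑ h, noetherAut K H h b) * nphi z hz (∑ g, noetherAut K G g c) := by
    intro b c
    rw [map_sum, map_sum, Finset.sum_mul_sum, Fintype.sum_prod_type]
    simp_rw [map_mul, eφy, eφz]
  have trace : ∀ b c, ∑ p, noetherAut K (H × G) p (nphi y hy b * nphi z hz c) ∈ M := by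
    intro b c
    rw [tr2]
    obtain ⟨w, hw⟩ := trfix b
    obtain ⟨w', hw'⟩ := trfix c
    rw [← hw, ← hw']
    exact mul_mem (hMy w) (hMz w')
  -- elements of trace one
  let cH : NoetherBigField K H := nx K 1 / ∑ γ : H, nx K γ
  let cG : NoetherBigField K G := nx K 1 / ∑ γ : G, nx K γ
  have cc : ∑ p, noetherAut K (H × G) p (nphi y hy cH * nphi z hz cG) = 1 := by
    rw [tr2, trone, trone, map_one, map_one, mul_one]
  let S := Set.range y ∪ Set.range z
  let R := Algebra.adjoin M S
  have r1 : ∀ r ∈ R, ∑ p, noetherAut K (H × G) p (nphi y hy cH * nphi z hz cG * r) ∈ M := by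
    intro r hr
    have hr' : r ∈ Submodule.span M (Submonoid.closure S : Set (NoetherBigField K (H × G))) := by
      rw [← Algebra.adjoin_eq_span]; exact hr
    clear hr
    induction hr' using Submodule.span_induction with
    | mem x hx =>
      rw [SetLike.mem_coe, Submonoid.closure_union, Submonoid.mem_sup] at hx
      obtain ⟨u, hu, v, hv, rfl⟩ := hx
      have hu' : u ∈ (MonoidHom.mrange (nphi y hy)) := by
        revert hu; revert u
        change Submonoid.closure (Set.range y) ≤ _
        rw [Submonoid.closure_le]
        rintro _ ⟨i, rfl⟩
        exact ⟨nx K i, nphi_nx y hy i⟩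
      have hv' : v ∈ (MonoidHom.mrange (nphi z hz)) := by
        revert hv; revert v
        change Submonoid.closure (Set.range z) ≤ _
        rw [Submonoid.closure_le]
        rintro _ ⟨i, rfl⟩
        exact ⟨nx K i, nphi_nx z hz i⟩
      obtain ⟨b, rfl⟩ := hu'
      obtain ⟨c, rfl⟩ := hv'
      have := trace (cH * b) (cG * c)
      rw [map_mul, map_mul] at this
      convert this using 3
      ring
    | zero => simp
    | add u v _ _ h1 h2 =>
      simp only [mul_add, map_add, Finset.sum_add_distrib]
      exact add_mem h1 h2
    | smul m u _ h1 =>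
      have : ∀ p, noetherAut K (H × G) p (nphi y hy cH * nphi z hz cG * m • u) =
          (m : NoetherBigField K (H × G)) *
            noetherAut K (H × G) p (nphi y hy cH * nphi z hz cG * u) := by
        intro p
        have h2 : m • u = (m : NoetherBigField K (H × G)) * u := rfl
        rw [h2, mul_left_comm, map_mul, hM p m m.2]
      simp_rw [this]
      rw [← Finset.mul_sum]
      exact mul_mem m.2 h1
  have r2 : ∀ p, ∀ r ∈ R, noetherAut K (H × G) p r ∈ R := by
    intro p r hr
    induction hr using Algebra.adjoin_induction with
    | mem x hx =>
      rcases hx with ⟨h, rfl⟩ | ⟨g, rfl⟩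
      · rw [ey]; exact Algebra.subset_adjoin (Or.inl ⟨_, rfl⟩)
      · rw [ez]; exact Algebra.subset_adjoin (Or.inr ⟨_, rfl⟩)
    | algebraMap m =>
      have h3 : algebraMap M (NoetherBigField K (H × G)) m = m := rfl
      rw [h3, hM p m m.2]; exact Subalgebra.algebraMap_mem R m
    | add u v _ _ h1 h2 => rw [map_add]; exact add_mem h1 h2
    | mul u v _ _ h1 h2 => rw [map_mul]; exact mul_mem h1 h2
  have r3 : ∀ r ∈ R, (∀ p, noetherAut K (H × G) p r = r) → r ∈ M := by
    intro r hr hf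
    have := r1 r hr
    simp_rw [map_mul _ (nphi y hy cH * nphi z hz cG) r, hf] at this
    rwa [← Finset.sum_mul, cc, one_mul] at this
  have htop : (IntermediateField.adjoin M S).restrictScalars K = ⊤ := by
    apply hgen
    · intro m hm
      exact IntermediateField.algebraMap_mem (IntermediateField.adjoin M S) ⟨m, hm⟩
    · exact fun h => IntermediateField.subset_adjoin M S (Or.inl ⟨h, rfl⟩)
    · exact fun h => IntermediateField.subset_adjoin M S (Or.inr ⟨h, rfl⟩)
  have haS : a ∈ IntermediateField.adjoin M S := by
    rw [← IntermediateField.mem_restrictScalars K, htop]; trivial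
  obtain ⟨r, hr, s, hs, hrs⟩ := IntermediateField.mem_adjoin_iff_div.1 haS
  by_cases hs0 : s = 0
  · rw [hrs, hs0, div_zero]; exact zero_mem _
  let n := ∏ p, noetherAut K (H × G) p s
  have hnR : n ∈ R := prod_mem fun p _ => r2 p s hs
  have hnf : ∀ q, noetherAut K (H × G) q n = n := by
    intro q
    simp only [n]
    rw [map_prod]
    simp_rw [← noetherAut_mul]
    exact Fintype.prod_equiv (Equiv.mulLeft q) _ _ (fun _ => rfl)
  have hn0 : n ≠ 0 := Finset.prod_ne_zero_iff.2 fun p _ => by simpa using hs0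
  have hnM := r3 n hnR hnf
  have han : a * n ∈ R := by
    have : a * n = r * ∏ p ∈ Finset.univ.erase 1, noetherAut K (H × G) p s := by
      simp only [n]
      rw [← Finset.mul_prod_erase Finset.univ _ (Finset.mem_univ 1), noetherAut_one, hrs]
      field_simp
    rw [this]
    exact mul_mem hr (prod_mem fun p _ => r2 p s hs)
  have hanM := r3 (a * n) han fun q => by rw [map_mul, ha, hnf]
  have : a = a * n / n := by field_simp
  rw [this]
  exact div_mem hanM hnM
end noether

section cases
variable {K : Type*} [Field K] {H G : Type*} [Group H] [Group G]

def niota {Γ : Type*} [Group Γ] (π : Γ → G) (z : G → NoetherBigField K Γ)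
    (hz : AlgebraicIndependent K z) (ez : ∀ p g, noetherAut K Γ p (z g) = z (π p * g)) :
    NoetherField K G →ₐ[K] NoetherField K Γ where
  toFun w := ⟨nphi z hz (nval K G w), fun p => by rw [nphi_equiv π z hz ez, nval_fixed]⟩
  map_one' := Subtype.ext (by simp; rfl)
  map_zero' := Subtype.ext (by simp; rfl)
  map_mul' a b := Subtype.ext (by simp; rfl)
  map_add' a b := Subtype.ext (by simp; rfl)
  commutes' c := Subtype.ext (by simp; rfl)

theorem nval_niota {Γ : Type*} [Group Γ] (π : Γ → G) (z : G → NoetherBigField K Γ)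
    (hz : AlgebraicIndependent K z) (ez : ∀ p g, noetherAut K Γ p (z g) = z (π p * g))
    (w : NoetherField K G) : nval K Γ (niota π z hz ez w) = nphi z hz (nval K G w) := rfl

theorem aux_final [Finite H] [Finite G]
    (y : H → NoetherBigField K (H × G)) (z : G → NoetherBigField K (H × G))
    (hy : AlgebraicIndependent K y) (hz : AlgebraicIndependent K z)
    (ey : ∀ p h, noetherAut K (H × G) p (y h) = y (p.1 * h))
    (ez : ∀ p g, noetherAut K (H × G) p (z g) = z (p.2 * g))
    {T : Type*} [Finite T] (B : T → NoetherField K (H × G))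
    (hcard : Nat.card T + Nat.card G = Nat.card H * Nat.card G)
    (h1 : ∀ M : IntermediateField K (NoetherBigField K (H × G)),
      (∀ w, nphi z hz (nval K G w) ∈ M) → (∀ t, nval K (H × G) (B t) ∈ M) →
        ∀ w, nphi y hy (nval K H w) ∈ M)
    (h2 : ∀ M : IntermediateField K (NoetherBigField K (H × G)),
      (∀ h, y h ∈ M) → (∀ g, z g ∈ M) → (∀ t, nval K (H × G) (B t) ∈ M) → M = ⊤) :
    ∃ ι : NoetherField K G →ₐ[K] NoetherField K (H × G),
      @IsRationalExtension (NoetherField K G) (NoetherField K (H × G)) _ _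
        ι.toRingHom.toAlgebra := by
  let ι := niota (fun p : H × G => p.2) z hz ez
  refine ⟨ι, ?_⟩
  let _ : Algebra (NoetherField K G) (NoetherField K (H × G)) := ι.toRingHom.toAlgebra
  have : IsScalarTower K (NoetherField K G) (NoetherField K (H × G)) := IsScalarTower.of_algHom ι
  let N := IntermediateField.adjoin (NoetherField K G) (Set.range B)
  let M : IntermediateField K (NoetherBigField K (H × G)) :=
    (N.restrictScalars K).map (nval K (H × G))
  have hMz : ∀ w, nphi z hz (nval K G w) ∈ M := by
    intro w
    exact ⟨ι w, IntermediateField.algebraMap_mem N w, rfl⟩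
  have hMB : ∀ t, nval K (H × G) (B t) ∈ M := by
    intro t
    exact ⟨B t, IntermediateField.subset_adjoin _ _ ⟨t, rfl⟩, rfl⟩
  have htop : N = ⊤ := by
    rw [eq_top_iff]
    intro a _
    have : nval K (H × G) a ∈ M := by
      refine aux_core y z hy hz ey ez M ?_ (h1 M hMz hMB) hMz ?_ _ (nval_fixed a)
      · rintro p _ ⟨b, _, rfl⟩
        exact nval_fixed b p
      · intro N' hN hy' hz'
        exact h2 N' hy' hz' fun t => hN (hMB t)
    obtain ⟨b, hb, hba⟩ := this
    have : b = a := (nval K (H × G)).injective hba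
    rw [← this]
    exact hb
  have htr : Algebra.trdeg (NoetherField K G) (NoetherField K (H × G)) = (Nat.card T : Cardinal) := by
    have := lift_trdeg_add_eq K (NoetherField K G) (NoetherField K (H × G))
    rw [noether_trdeg, noether_trdeg, Nat.card_prod, ← hcard, Cardinal.lift_natCast,
      Cardinal.lift_natCast, Nat.cast_add, add_comm,
      Cardinal.add_right_inj_of_lt_aleph0 Cardinal.natCast_lt_aleph0] at this
    exact Cardinal.lift_eq_nat_iff.1 this
  exact aux_rational_of B (aux_of_gen B htop htr le_rfl).1 htop

/-- If the generators of `K(H)` land in `M` so does all of `K(H)`. -/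
theorem aux_gen_mem {L : Type*} [Field L] [Algebra K L] {n : ℕ} (f : Fin n → NoetherField K H)
    (hf : IntermediateField.adjoin K (Set.range f) = ⊤) (φ : NoetherField K H →ₐ[K] L)
    (M : IntermediateField K L) (hM : ∀ i, φ (f i) ∈ M) (w : NoetherField K H) : φ w ∈ M := by
  have : (⊤ : IntermediateField K (NoetherField K H)) ≤ M.comap φ := by
    rw [← hf, IntermediateField.adjoin_le_iff]
    rintro _ ⟨i, rfl⟩
    exact hM i
  exact this (x := w) trivial

theorem aux_big_gen {ι : Type*} (M : IntermediateField K (FractionRing (MvPolynomial ι K)))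
    (h : ∀ i, nx K i ∈ M) : M = ⊤ := by
  rw [eq_top_iff, ← aux_frac_gen K ι, IntermediateField.adjoin_le_iff]
  rintro _ ⟨i, rfl⟩
  exact h i

/-- row sums -/
def ysum (K : Type*) [Field K] (H G : Type*) [Group H] [Group G] [Fintype G] (h : H) :
    NoetherBigField K (H × G) := ∑ g, nx K (h, g)

def zsum (K : Type*) [Field K] (H G : Type*) [Group H] [Group G] [Fintype H] (g : G) :
    NoetherBigField K (H × G) := ∑ h, nx K (h, g)

theorem ysum_equiv [Fintype G] (p : H × G) (h : H) :
    noetherAut K (H × G) p (ysum K H G h) = ysum K H G (p.1 * h) := by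
  unfold ysum
  rw [map_sum]
  simp_rw [noetherAut_nx]
  exact Fintype.sum_equiv (Equiv.mulLeft p.2) _ _ (fun _ => rfl)

theorem zsum_equiv [Fintype H] (p : H × G) (g : G) :
    noetherAut K (H × G) p (zsum K H G g) = zsum K H G (p.2 * g) := by
  unfold zsum
  rw [map_sum]
  simp_rw [noetherAut_nx]
  exact Fintype.sum_equiv (Equiv.mulLeft p.1) _ _ (fun _ => rfl)

theorem ysum_indep [Fintype G] : AlgebraicIndependent K (ysum K H G) := by
  classical
  have h1 : AlgebraicIndependent K (fun h : H => ∑ g : G, (MvPolynomial.X (h, g) : MvPolynomial (H × G) K)) := by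
    apply AlgebraicIndependent.of_comp (MvPolynomial.aeval
      (fun p : H × G => if p.2 = 1 then (MvPolynomial.X p.1 : MvPolynomial H K) else 0))
    have : (⇑(MvPolynomial.aeval
      (fun p : H × G => if p.2 = 1 then (MvPolynomial.X p.1 : MvPolynomial H K) else 0)) ∘
      (fun h : H => ∑ g : G, (MvPolynomial.X (h, g) : MvPolynomial (H × G) K))) = MvPolynomial.X := by
      funext h
      simp
    rw [this]
    exact MvPolynomial.algebraicIndependent_X H K
  have h2 := h1.map' (f := IsScalarTower.toAlgHom K (MvPolynomial (H × G) K) (NoetherBigField K (H × G)))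
    (IsFractionRing.injective (MvPolynomial (H × G) K) _)
  convert h2 using 1
  funext h
  simp [ysum, nx]

theorem case_H [Finite H] [Finite G] (hs : Subsingleton H) :
    ∃ ι : NoetherField K G →ₐ[K] NoetherField K (H × G),
      @IsRationalExtension (NoetherField K G) (NoetherField K (H × G)) _ _
        ι.toRingHom.toAlgebra := by
  have := Fintype.ofFinite H
  have := Fintype.ofFinite G
  have hz : AlgebraicIndependent K (fun g : G => (nx K ((1 : H), g) : NoetherBigField K (H × G))) :=
    (aux_frac_indep K (H × G)).comp (fun g : G => ((1 : H), g)) (fun a b hab => (Prod.ext_iff.1 hab).2)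
  refine aux_final (ysum K H G) (fun g => nx K (1, g)) ysum_indep hz ysum_equiv ?_
    (T := Empty) Empty.elim (by rw [Nat.card_of_subsingleton (1 : H)]; simp) ?_ ?_
  · intro p g
    rw [noetherAut_nx]
    congr 1
    exact Prod.ext (Subsingleton.elim _ _) rfl
  · intro M hM _ w
    have key : ∀ b, nphi (ysum K H G) ysum_indep b ∈ M := by
      intro b
      have : M.comap (nphi (ysum K H G) ysum_indep) = ⊤ := by
        apply aux_big_gen
        intro i
        change nphi (ysum K H G) ysum_indep (nx K i) ∈ M
        rw [nphi_nx]
        obtain ⟨w, hw⟩ := trfix (nx K (1 : G))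
        have := hM w
        rw [hw] at this
        convert this
        simp only [noetherAut_nx, map_sum, nphi_nx, ysum, mul_one, Subsingleton.elim i 1]
      have hb : b ∈ M.comap (nphi (ysum K H G) ysum_indep) := by rw [this]; trivial
      exact hb
    exact key _
  · intro M _ hz _
    apply aux_big_gen
    rintro ⟨h, g⟩
    rw [Subsingleton.elim h 1]
    exact hz g

theorem case_G [Finite H] [Finite G] (hs : Subsingleton G)
    (hH : IsRationalExtension K (NoetherField K H)) :
    ∃ ι : NoetherField K G →ₐ[K] NoetherField K (H × G),
      @IsRationalExtension (NoetherField K G) (NoetherField K (H × G)) _ _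
        ι.toRingHom.toAlgebra := by
  have := Fintype.ofFinite H
  have := Fintype.ofFinite G
  obtain ⟨n, f, hf, hf', hn⟩ := aux_rational_iff hH
  have hnH : Nat.card H = n := by
    rw [noether_trdeg] at hn; exact_mod_cast hn
  obtain ⟨m, rfl⟩ : ∃ m, n = m + 1 := Nat.exists_eq_succ_of_ne_zero (by rw [← hnH]; exact Nat.card_pos.ne')
  have hGc : Nat.card G = 1 := Nat.card_of_subsingleton 1
  let φ : NoetherField K H →ₐ[K] NoetherField K (H × G) :=
    niota (fun p : H × G => p.1) (ysum K H G) ysum_indep ysum_equiv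
  have hz : AlgebraicIndependent K (fun _ : G => nval K (H × G) (φ (f 0))) :=
    (hf.map' (f := (nval K (H × G)).comp φ) (RingHom.injective _)).comp (fun _ : G => 0)
      (fun a b _ => Subsingleton.elim a b)
  refine aux_final (ysum K H G) (fun _ => nval K (H × G) (φ (f 0))) ysum_indep hz ysum_equiv ?_
    (T := Fin m) (fun i => φ (f i.succ)) (by rw [hnH, hGc]; simp) ?_ ?_
  · intro p g
    exact nval_fixed _ _
  · intro M hM hB w
    refine aux_gen_mem f hf' ((nval K (H × G)).comp φ) M ?_ w
    intro i
    refine Fin.cases ?_ hB i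
    obtain ⟨w, hw⟩ := trfix (nx K (1 : G))
    have := hM w
    rw [hw] at this
    simp only [noetherAut_nx, map_sum, nphi_nx] at this
    convert this
    rw [Finset.sum_const, Finset.card_univ, ← Nat.card_eq_fintype_card, hGc, one_smul]
    rfl
  · intro M hy _ _
    apply aux_big_gen
    rintro ⟨h, g⟩
    have := hy h
    unfold ysum at this
    convert this
    rw [Fintype.sum_subsingleton _ g]

end cases

section main
variable {K : Type*} [Field K] {H G : Type*} [Group H] [Group G]

def tsum' (K : Type*) [Field K] (H G : Type*) [Group H] [Group G] [Fintype H] [Fintype G] (i j : ℕ) :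
    NoetherBigField K (H × G) :=
  ∑ h, ysum K H G h ^ i * ∑ g, zsum K H G g ^ j * nx K (h, g)

theorem tsum'_fixed [Fintype H] [Fintype G] (i j : ℕ) (p : H × G) :
    noetherAut K (H × G) p (tsum' K H G i j) = tsum' K H G i j := by
  unfold tsum'
  simp_rw [map_sum, map_mul, map_sum, map_mul, map_pow, ysum_equiv, zsum_equiv, noetherAut_nx]
  refine Fintype.sum_equiv (Equiv.mulLeft p.1) _ _ (fun h => ?_)
  congr 1
  exact Fintype.sum_equiv (Equiv.mulLeft p.2) _ _ (fun g => rfl)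

theorem sum_ysum_fixed [Fintype H] [Fintype G] (p : H × G) :
    noetherAut K (H × G) p (∑ h, ysum K H G h) = ∑ h, ysum K H G h := by
  simp_rw [map_sum, ysum_equiv]
  exact Fintype.sum_equiv (Equiv.mulLeft p.1) _ _ (fun h => rfl)

theorem sum_ysum_eq [Fintype H] [Fintype G] : ∑ h, ysum K H G h = ∑ g, zsum K H G g :=
  Finset.sum_comm

theorem sum_ysum_ne [Fintype H] [Fintype G] : ∑ h, ysum K H G h ≠ 0 := by
  classical
  have := aux_ne_zero (K := K) (fun g : H × G => if g = 1 then 1 else 0)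
    (∑ h, ∑ g, MvPolynomial.X (h, g)) (by
      simp only [map_sum, MvPolynomial.eval_X]
      rw [← Fintype.sum_prod_type' (f := fun a b => if (a, b) = (1 : H × G) then (1 : K) else 0)]
      simp)
  simp only [map_sum] at this
  exact this

theorem tsum'_ne [Fintype H] [Fintype G] : tsum' K H G 1 1 ≠ 0 := by
  classical
  have := aux_ne_zero (K := K) (fun g : H × G => if g.1 = 1 then (if g.2 = 1 then 1 else 0) else 0)
    (∑ h, (∑ g, MvPolynomial.X (h, g)) ^ 1 *
      ∑ g, (∑ h, MvPolynomial.X (h, g)) ^ 1 * MvPolynomial.X (h, g)) (by simp)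
  simp only [map_sum, map_mul, map_pow] at this
  exact this

theorem zsum_inj [Fintype H] : Function.Injective (zsum K H G) := by
  classical
  intro g g' h
  by_contra hne
  have := aux_ne_zero (K := K) (fun p : H × G => if p.1 = 1 then (if p.2 = g then 1 else 0) else 0)
    (∑ h, MvPolynomial.X (h, g) - ∑ h, MvPolynomial.X (h, g')) (by simp [Ne.symm hne])
  rw [map_sub, map_sum, map_sum] at this
  exact this (sub_eq_zero.2 h)

theorem case_main [Finite H] [Finite G] (a b : ℕ) (hcH : Nat.card H = a + 2)
    (hcG : Nat.card G = b + 2) (hH : IsRationalExtension K (NoetherField K H)) :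
    ∃ ι : NoetherField K G →ₐ[K] NoetherField K (H × G),
      @IsRationalExtension (NoetherField K G) (NoetherField K (H × G)) _ _
        ι.toRingHom.toAlgebra := by
  classical
  have := Fintype.ofFinite H
  have := Fintype.ofFinite G
  obtain ⟨n, f, hf, hf', hn⟩ := aux_rational_iff hH
  have hnH : Nat.card H = n := by
    rw [noether_trdeg] at hn; exact_mod_cast hn
  let T := {p : Fin (a + 1) × Fin (b + 1) // p ≠ (0, 0)}
  have hT : Nat.card T + 1 = (a + 1) * (b + 1) := by
    have := Fintype.card_subtype_compl (fun p : Fin (a + 1) × Fin (b + 1) => p = (0, 0))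
    have h3 : 0 < (a + 1) * (b + 1) := by positivity
    rw [Fintype.card_subtype_eq, Fintype.card_prod, Fintype.card_fin, Fintype.card_fin] at this
    rw [Nat.card_eq_fintype_card]
    have h4 : Fintype.card T = (a + 1) * (b + 1) - 1 := by rw [← this]
    omega
  let s := ∑ h, ysum K H G h
  let z : G → NoetherBigField K (H × G) := fun g => tsum' K H G 1 1 * zsum K H G g / s
  let t : T → NoetherBigField K (H × G) := fun p => tsum' K H G (p.1.1 + 1) (p.1.2 + 1)
  have ez : ∀ p g, noetherAut K (H × G) p (z g) = z (p.2 * g) := by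
    intro p g
    simp only [z, s]
    rw [map_div₀, map_mul, tsum'_fixed, sum_ysum_fixed, zsum_equiv]
  have hgen : ∀ M : IntermediateField K (NoetherBigField K (H × G)),
      (∀ h, ysum K H G h ∈ M) → (∀ g, z g ∈ M) → (∀ p, t p ∈ M) → M = ⊤ := by
    intro M hy hz ht
    have hs : s ∈ M := sum_mem fun h _ => hy h
    have hs0 : s ≠ 0 := sum_ysum_ne
    have h11 : tsum' K H G 1 1 ∈ M := by
      have h5 : ∑ g, z g ∈ M := sum_mem fun h _ => hz h
      have h6 : ∑ g, z g = tsum' K H G 1 1 := by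
        simp only [z]
        rw [← Finset.sum_div, ← Finset.mul_sum, ← sum_ysum_eq]
        exact mul_div_cancel_right₀ _ hs0
      rwa [h6] at h5
    have h110 : tsum' K H G 1 1 ≠ 0 := tsum'_ne
    have hzs : ∀ g, zsum K H G g ∈ M := by
      intro g
      have h7 : zsum K H G g = z g * s / tsum' K H G 1 1 := by
        simp only [z]; field_simp
      rw [h7]
      exact div_mem (mul_mem (hz g) hs) h11
    have hall : ∀ i < Nat.card H, ∀ j < Nat.card G, tsum' K H G i j ∈ M := by
      intro i hi j hj
      rcases i with _ | i
      · have : tsum' K H G 0 j = ∑ g, zsum K H G g ^ j * zsum K H G g := by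
          simp only [tsum', pow_zero, one_mul]
          rw [Finset.sum_comm]
          refine Finset.sum_congr rfl fun g _ => ?_
          rw [← Finset.mul_sum]; rfl
        rw [this]
        exact sum_mem fun g _ => mul_mem (pow_mem (hzs g) _) (hzs g)
      rcases j with _ | j
      · have : tsum' K H G (i + 1) 0 = ∑ h, ysum K H G h ^ (i + 1) * ysum K H G h := by
          simp only [tsum', pow_zero, one_mul]; rfl
        rw [this]
        exact sum_mem fun g _ => mul_mem (pow_mem (hy g) _) (hy g)
      by_cases h00 : i = 0 ∧ j = 0
      · obtain ⟨rfl, rfl⟩ := h00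
        exact h11
      · refine ht ⟨(⟨i, by omega⟩, ⟨j, by omega⟩), ?_⟩
        intro h
        rw [Prod.ext_iff, Fin.ext_iff, Fin.ext_iff] at h
        exact h00 h
    apply aux_big_gen
    rintro ⟨h, g⟩
    refine aux_vandermonde M (zsum K H G) (fun g => nx K (h, g)) zsum_inj hzs ?_ g
    intro j hj
    refine aux_vandermonde M (ysum K H G) (fun h => ∑ g, zsum K H G g ^ j * nx K (h, g))
      ysum_indep.injective hy ?_ h
    intro i hi
    exact hall i (by rwa [Nat.card_eq_fintype_card]) j (by rwa [Nat.card_eq_fintype_card])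
  have hind : AlgebraicIndependent K (Sum.elim (ysum K H G) (Sum.elim z t)) := by
    refine (aux_of_gen _ (hgen _ ?_ ?_ ?_) (aux_trdeg_frac K (H × G)) ?_).1
    · exact fun h => IntermediateField.subset_adjoin _ _ ⟨Sum.inl h, rfl⟩
    · exact fun h => IntermediateField.subset_adjoin _ _ ⟨Sum.inr (Sum.inl h), rfl⟩
    · exact fun h => IntermediateField.subset_adjoin _ _ ⟨Sum.inr (Sum.inr h), rfl⟩
    · rw [Nat.card_sum, Nat.card_sum, Nat.card_prod, hcH, hcG]
      nlinarith
  have hz : AlgebraicIndependent K z :=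
    hind.comp (Sum.inr ∘ Sum.inl) (Sum.inr_injective.comp Sum.inl_injective)
  let φ : NoetherField K H →ₐ[K] NoetherField K (H × G) :=
    niota (fun p : H × G => p.1) (ysum K H G) ysum_indep ysum_equiv
  have ht : ∀ p, ∃ w, nval K (H × G) w = t p := fun p => nval_surj _ fun q => tsum'_fixed _ _ q
  choose t' ht' using ht
  refine aux_final (ysum K H G) z ysum_indep hz ysum_equiv ez
    (T := Fin n ⊕ T) (Sum.elim (fun i => φ (f i)) t') ?_ ?_ ?_
  · rw [Nat.card_sum, hcG, hcH, Nat.card_fin, ← hnH, hcH]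
    nlinarith
  · intro M _ hB w
    refine aux_gen_mem f hf' ((nval K (H × G)).comp φ) M ?_ w
    intro i
    exact hB (Sum.inl i)
  · intro M hy hz hB
    refine hgen M hy hz fun p => ?_
    rw [← ht']
    exact hB (Sum.inr p)

end main

/-- Theorem 1.9 (rational case): if `K(H)` is rational over `K`, then there is a `K`-embedding
of `K(G)` into `K(H × G)` making `K(H × G)` rational over (the image of) `K(G)`; in
particular, if both `K(H)` and `K(G)` are rational over `K`, so is `K(H × G)`. -/
theorem noether_rational_direct_product
    (K : Type*) [Field K] (H G : Type*) [Group H] [Group G] [Finite H] [Finite G]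
    (hH : IsRationalExtension K (NoetherField K H)) :
    (∃ ι : NoetherField K G →ₐ[K] NoetherField K (H × G),
      @IsRationalExtension (NoetherField K G) (NoetherField K (H × G)) _ _
        ι.toRingHom.toAlgebra) ∧
    (IsRationalExtension K (NoetherField K G) →
      IsRationalExtension K (NoetherField K (H × G))) := by
  have hex : ∃ ι : NoetherField K G →ₐ[K] NoetherField K (H × G),
      @IsRationalExtension (NoetherField K G) (NoetherField K (H × G)) _ _
        ι.toRingHom.toAlgebra := by
    by_cases h1 : Subsingleton H
    · exact case_H h1
    by_cases h2 : Subsingleton G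
    · exact case_G h2 hH
    rw [not_subsingleton_iff_nontrivial] at h1 h2
    have c1 := Finite.one_lt_card (α := H)
    have c2 := Finite.one_lt_card (α := G)
    exact case_main (Nat.card H - 2) (Nat.card G - 2) (by omega) (by omega) hH
  refine ⟨hex, fun hG => ?_⟩
  obtain ⟨ι, hι⟩ := hex
  let _ : Algebra (NoetherField K G) (NoetherField K (H × G)) := ι.toRingHom.toAlgebra
  have : IsScalarTower K (NoetherField K G) (NoetherField K (H × G)) := IsScalarTower.of_algHom ι
  exact aux_rational_trans hG hι

end
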